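/- Let X be a paracompact Hausdorff space with covering dimension dim(X) ≤ n, Y a Hausdorff topological space, and φ_0, …, φ_n : X ⇝ Y a finite aspherical sequence of lower locally constant set-valued mappings. Then φ_n has a continuous selection. -/

import Mathlib

/-- `EmbedIn k S B` means `S ↪_k B`: every continuous map from the unit `k`-sphere of
`ℝ^{k+1}` into `S` extends to a continuous map from the closed unit `(k+1)`-ball into `B`. -/
def EmbedIn {Y : Type*} [TopologicalSpace Y] (k : ℕ) (S B : Set Y) : Prop :=
  ∀ f : (Metric.sphere (0 : EuclideanSpace ℝ (Fin (k + 1))) 1) → Y,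
    Continuous f → Set.range f ⊆ S →
      ∃ g : (Metric.closedBall (0 : EuclideanSpace ℝ (Fin (k + 1))) 1) → Y,
        Continuous g ∧ Set.range g ⊆ B ∧
          ∀ z, g (Set.inclusion Metric.sphere_subset_closedBall z) = f z

/-- A set-valued mapping `Φ : X ⇝ Y` is lower locally constant if
`{x | K ⊆ Φ x}` is open for every compact `K ⊆ Y`. -/
def LowerLocallyConstant {X Y : Type*} [TopologicalSpace X] [TopologicalSpace Y]
    (Φ : X → Set Y) : Prop :=
  ∀ K : Set Y, IsCompact K → IsOpen {x | K ⊆ Φ x}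

/-- `X` has covering dimension at most `n`: every open cover of `X` admits an open
refinement covering `X` in which every point belongs to at most `n + 1` members. -/
def CovDimLE (X : Type*) [TopologicalSpace X] (n : ℕ) : Prop :=
  ∀ U : Set (Set X), (∀ u ∈ U, IsOpen u) → ⋃₀ U = Set.univ →
    ∃ V : Set (Set X),
      (∀ v ∈ V, IsOpen v) ∧
      (∀ v ∈ V, ∃ u ∈ U, v ⊆ u) ∧
      ⋃₀ V = Set.univ ∧
      ∀ x : X, {v ∈ V | x ∈ v}.Finite ∧ {v ∈ V | x ∈ v}.ncard ≤ n + 1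

/-- The finite-support simplex spanned by the vertices in `σ`, inside `I → ℝ`. -/
def finsetSimplex {I : Type*} (σ : Finset I) : Set (I → ℝ) :=
  {p | (∀ i, 0 ≤ p i) ∧ (∀ i, i ∉ σ → p i = 0) ∧ ∑ i ∈ σ, p i = 1}

theorem isClosed_finsetSimplex {I : Type*} (σ : Finset I) : IsClosed (finsetSimplex σ) := by
  simp only [finsetSimplex, Set.ofPred_and, Set.ofPred_forall]
  refine (isClosed_iInter fun i => isClosed_le continuous_const (continuous_apply i)).inter
    ((isClosed_iInter fun i => isClosed_iInter fun _ =>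
      isClosed_eq (continuous_apply i) continuous_const).inter
      (isClosed_eq (by fun_prop) continuous_const))

theorem isCompact_finsetSimplex {I : Type*} (σ : Finset I) : IsCompact (finsetSimplex σ) := by
  refine (isCompact_univ_pi fun _ : I => isCompact_Icc (a := (0 : ℝ)) (b := 1)).of_isClosed_subset
    (isClosed_finsetSimplex σ) fun p hp i _ => ⟨hp.1 i, ?_⟩
  by_cases hi : i ∈ σ
  · rw [← hp.2.2]
    exact Finset.single_le_sum (fun j _ => hp.1 j) hi
  · rw [hp.2.1 i hi]
    exact zero_le_one

theorem finsetSimplex_mono {I : Type*} {σ τ : Finset I} (h : σ ⊆ τ) :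
    finsetSimplex σ ⊆ finsetSimplex τ := fun p hp =>
  ⟨hp.1, fun i hi => hp.2.1 i fun hi' => hi (h hi'), by
    rw [← hp.2.2]
    exact (Finset.sum_subset h fun i _ hi => hp.2.1 i hi).symm⟩

theorem mem_finsetSimplex_of_subset {I : Type*} {σ τ : Finset I} {p : I → ℝ} (h : σ ⊆ τ)
    (hp : p ∈ finsetSimplex τ) (h0 : ∀ i, i ∉ σ → p i = 0) : p ∈ finsetSimplex σ :=
  ⟨hp.1, h0, by
    rw [← hp.2.2]
    exact Finset.sum_subset h fun i _ hi => h0 i hi⟩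

/-- The map on barycentric coordinates induced by a map of vertices. -/
noncomputable def vertexPushforward {J I : Type*} (r : J → I) (q : J → ℝ) (i : I) : ℝ :=
  ∑ᶠ j, (r ⁻¹' {i}).indicator q j

open Classical in
theorem vertexPushforward_eq_sum {J I : Type*} (r : J → I) {q : J → ℝ} {τ : Finset J}
    (hq : q ∈ finsetSimplex τ) (i : I) :
    vertexPushforward r q i = ∑ j ∈ τ, if r j = i then q j else 0 := by
  rw [vertexPushforward, finsum_eq_sum_of_support_subset (s := τ)]
  · exact Finset.sum_congr rfl fun j _ => by simp [Set.indicator_apply]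
  · intro j hj
    by_contra hjτ
    exact hj (by simp [Set.indicator_apply, hq.2.1 j hjτ])

theorem continuousOn_vertexPushforward {J I : Type*} (r : J → I) (τ : Finset J) :
    ContinuousOn (vertexPushforward r) (finsetSimplex τ) := by
  classical
  refine continuousOn_pi.2 fun i => ContinuousOn.congr (f := fun q : J → ℝ =>
    ∑ j ∈ τ, if r j = i then q j else 0) ?_ fun q hq => vertexPushforward_eq_sum r hq i
  refine Continuous.continuousOn (continuous_finsetSum _ fun j _ => ?_)
  split_ifs <;> fun_prop

open Classical in
theorem vertexPushforward_mem {J I : Type*} (r : J → I) {q : J → ℝ} {τ : Finset J}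
    (hq : q ∈ finsetSimplex τ) : vertexPushforward r q ∈ finsetSimplex (τ.image r) := by
  refine ⟨fun i => ?_, fun i hi => ?_, ?_⟩
  · rw [vertexPushforward_eq_sum r hq]
    exact Finset.sum_nonneg fun j _ => by split_ifs <;> simp [hq.1 j]
  · rw [vertexPushforward_eq_sum r hq]
    exact Finset.sum_eq_zero fun j hj => if_neg fun h =>
      hi (Finset.mem_image.2 ⟨j, hj, h⟩)
  · simp_rw [vertexPushforward_eq_sum r hq]
    rw [Finset.sum_comm, ← hq.2.2]
    exact Finset.sum_congr rfl fun j hj => by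
      rw [Finset.sum_ite_eq, if_pos (Finset.mem_image_of_mem r hj)]

/-- Barycentric coordinates with respect to the corner simplex of `ℝ^{k+1}`. -/
noncomputable def cornerCoord {k : ℕ} (v : EuclideanSpace ℝ (Fin (k + 1))) : Fin (k + 2) → ℝ :=
  Fin.cons (1 - ∑ i, v i) fun i => v i

theorem continuous_cornerCoord {k : ℕ} (j : Fin (k + 2)) :
    Continuous fun v : EuclideanSpace ℝ (Fin (k + 1)) => cornerCoord v j := by
  refine Fin.cases ?_ (fun i => ?_) j <;> simp only [cornerCoord, Fin.cons_zero, Fin.cons_succ] <;>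
    fun_prop

theorem sum_cornerCoord {k : ℕ} (v : EuclideanSpace ℝ (Fin (k + 1))) :
    ∑ j, cornerCoord v j = 1 := by
  simp [Fin.sum_univ_succ (n := k + 1), cornerCoord]

theorem isOpenMap_cornerCoord {k : ℕ} (j : Fin (k + 2)) :
    IsOpenMap fun v : EuclideanSpace ℝ (Fin (k + 1)) => cornerCoord v j := by
  refine Fin.cases ?_ (fun i => ?_) j
  · let l : EuclideanSpace ℝ (Fin (k + 1)) →L[ℝ] ℝ :=
      ∑ i, EuclideanSpace.proj i
    have hl : IsOpenMap l := l.isOpenMap fun t =>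
      ⟨EuclideanSpace.single 0 t, by simp [l]⟩
    have h := (Homeomorph.subLeft (1 : ℝ)).isOpenMap.comp hl
    convert h using 2 with v
    simp [cornerCoord, l]
  · let l : EuclideanSpace ℝ (Fin (k + 1)) →L[ℝ] ℝ :=
      EuclideanSpace.proj i
    have hl : IsOpenMap l := l.isOpenMap fun t => ⟨EuclideanSpace.single i t, by simp [l]⟩
    convert hl using 2 with v
    simp [cornerCoord, l]

theorem interior_cornerSimplex (k : ℕ) :
    interior {v : EuclideanSpace ℝ (Fin (k + 1)) | ∀ j, 0 ≤ cornerCoord v j} =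
      {v | ∀ j, 0 < cornerCoord v j} := by
  apply subset_antisymm
  · intro v hv j
    have h : v ∈ interior ((fun v => cornerCoord v j) ⁻¹' Set.Ici 0) :=
      interior_mono (fun w (hw : ∀ j, 0 ≤ cornerCoord w j) => hw j) hv
    rw [← (isOpenMap_cornerCoord j).preimage_interior_eq_interior_preimage
      (continuous_cornerCoord j), interior_Ici] at h
    exact h
  · refine interior_maximal (fun v hv j => (hv j).le) ?_
    simp only [Set.ofPred_forall]
    exact isOpen_iInter_of_finite fun j => isOpen_lt continuous_const (continuous_cornerCoord j)

/-- The closed unit ball and the corner simplex are homeomorphic as pairs with their boundaries. -/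
theorem exists_homeomorph_cornerSimplex_closedBall (k : ℕ) :
    ∃ h : EuclideanSpace ℝ (Fin (k + 1)) ≃ₜ EuclideanSpace ℝ (Fin (k + 1)), ∀ v,
      (h v ∈ Metric.closedBall 0 1 ↔ ∀ j, 0 ≤ cornerCoord v j) ∧
      (h v ∈ Metric.sphere 0 1 ↔ (∀ j, 0 ≤ cornerCoord v j) ∧ ∃ j, cornerCoord v j = 0) := by
  set s : Set (EuclideanSpace ℝ (Fin (k + 1))) := {v | ∀ j, 0 ≤ cornerCoord v j} with hs
  have hclosed : IsClosed s := by
    simp only [hs, Set.ofPred_forall]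
    exact isClosed_iInter fun j => isClosed_le continuous_const (continuous_cornerCoord j)
  have hconv : Convex ℝ s := by
    intro v hv w hw a b ha hb hab j
    have : cornerCoord (a • v + b • w) j = a * cornerCoord v j + b * cornerCoord w j := by
      refine Fin.cases ?_ (fun i => ?_) j
      · simp only [cornerCoord, Fin.cons_zero, PiLp.add_apply, PiLp.smul_apply, smul_eq_mul,
          Finset.sum_add_distrib, ← Finset.mul_sum]
        linear_combination -hab
      · simp [cornerCoord]
    rw [this]
    exact add_nonneg (mul_nonneg ha (hv j)) (mul_nonneg hb (hw j))
  have hne : (interior s).Nonempty := by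
    rw [hs, interior_cornerSimplex]
    refine ⟨WithLp.toLp 2 fun _ => 1 / ((k : ℝ) + 2), fun j => ?_⟩
    refine Fin.cases ?_ (fun i => ?_) j
    · simp only [cornerCoord, Fin.cons_zero, Finset.sum_const, Finset.card_univ, Fintype.card_fin,
        nsmul_eq_mul]
      have : (0 : ℝ) < k + 2 := by positivity
      push_cast
      rw [mul_one_div, sub_pos, div_lt_one this]
      linarith
    · simp only [cornerCoord, Fin.cons_succ]
      positivity
  have hbdd : Bornology.IsBounded s := by
    have hc : IsCompact ((WithLp.toLp 2 : (Fin (k + 1) → ℝ) → EuclideanSpace ℝ (Fin (k + 1))) ''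
        Set.univ.pi fun _ => Set.Icc (0 : ℝ) 1) :=
      (isCompact_univ_pi fun _ => isCompact_Icc).image (PiLp.continuous_toLp 2 _)
    refine hc.isBounded.subset fun v hv => ⟨fun i => v i, fun i _ => ?_, rfl⟩
    have h (j : Fin (k + 2)) : cornerCoord v j ≤ 1 := by
      rw [← sum_cornerCoord v]
      exact Finset.single_le_sum (fun j _ => hv j) (Finset.mem_univ j)
    exact ⟨by simpa [cornerCoord] using hv i.succ, by simpa [cornerCoord] using h i.succ⟩
  obtain ⟨h, -, h1, h2⟩ :=
    exists_homeomorph_image_interior_closure_frontier_eq_unitBall hconv hne hbdd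
  refine ⟨h, fun v => ⟨?_, ?_⟩⟩
  · rw [← h1, h.injective.mem_set_image, hclosed.closure_eq]
    rfl
  · rw [← h2, h.injective.mem_set_image, hclosed.frontier_eq, hs, interior_cornerSimplex]
    refine and_congr_right fun hv => ?_
    simp only [Set.mem_ofPred_eq, not_forall, not_lt]
    exact exists_congr fun j => ⟨fun hj => le_antisymm hj (hv j), le_of_eq⟩

theorem continuousOn_biUnion_finset {α β ι : Type*} [TopologicalSpace α] [TopologicalSpace β]
    {f : α → β} (T : Finset ι) {s : ι → Set α} (hs : ∀ i ∈ T, IsClosed (s i))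
    (hf : ∀ i ∈ T, ContinuousOn f (s i)) : ContinuousOn f (⋃ i ∈ T, s i) := by
  change ContinuousOn f (⋃ i ∈ (T : Set ι), s i)
  rw [Set.biUnion_eq_iUnion]
  exact (locallyFinite_of_finite fun i : (T : Set ι) => s i).continuousOn_iUnion
    (fun i => hs i i.2) fun i => hf i i.2

open Classical in
/-- If `S ↪_k B`, a map given on the boundary of a `(k+1)`-simplex with values in `S` extends over
the simplex with values in `B`. -/
theorem EmbedIn.exists_extension_finsetSimplex {I Y : Type*} [TopologicalSpace Y] {k : ℕ}
    {S B : Set Y} (h : EmbedIn k S B) {σ : Finset I} (hσ : σ.card = k + 2) {u : (I → ℝ) → Y}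
    (hu : ∀ τ ⊆ σ, τ.card ≤ k + 1 →
      ContinuousOn u (finsetSimplex τ) ∧ Set.MapsTo u (finsetSimplex τ) S) :
    ∃ g : (I → ℝ) → Y, ContinuousOn g (finsetSimplex σ) ∧ Set.MapsTo g (finsetSimplex σ) B ∧
      ∀ τ ⊆ σ, τ.card ≤ k + 1 → Set.EqOn g u (finsetSimplex τ) := by
  obtain ⟨H, hH⟩ := exists_homeomorph_cornerSimplex_closedBall k
  let e : Fin (k + 2) ≃ σ := (σ.equivFinOfCardEq hσ).symm
  let c : EuclideanSpace ℝ (Fin (k + 1)) → I → ℝ := fun v i =>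
    if hi : i ∈ σ then cornerCoord v (e.symm ⟨i, hi⟩) else 0
  let d : (I → ℝ) → EuclideanSpace ℝ (Fin (k + 1)) := fun p => WithLp.toLp 2 fun i => p (e i.succ)
  have hc : Continuous c := continuous_pi fun i => by
    by_cases hi : i ∈ σ
    · simpa only [c, dif_pos hi] using continuous_cornerCoord _
    · simpa only [c, dif_neg hi] using continuous_const
  have hd : Continuous d := (PiLp.continuous_toLp 2 _).comp (by fun_prop)
  have hdc : ∀ p ∈ finsetSimplex σ, ∀ j, cornerCoord (d p) j = p (e j) := by
    intro p hp j
    have hsum : ∑ j, p (e j) = 1 := by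
      rw [← hp.2.2, ← Finset.sum_coe_sort σ, e.sum_comp fun i : σ => p i]
    refine Fin.cases ?_ (fun i => ?_) j
    · rw [Fin.sum_univ_succ] at hsum
      simp only [cornerCoord, Fin.cons_zero, d]
      linarith
    · simp [cornerCoord, d]
  have hcd : ∀ p ∈ finsetSimplex σ, c (d p) = p := by
    intro p hp
    funext i
    by_cases hi : i ∈ σ
    · simp only [c, dif_pos hi]
      rw [hdc p hp, e.apply_symm_apply]
    · simp only [c, dif_neg hi, hp.2.1 i hi]
  have hce : ∀ v j, c v (e j) = cornerCoord v j := fun v j => by simp [c]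
  have hcmem : ∀ v, (∀ j, 0 ≤ cornerCoord v j) → c v ∈ finsetSimplex σ := by
    intro v hv
    refine ⟨fun i => ?_, fun i hi => by simp only [c, dif_neg hi], ?_⟩
    · by_cases hi : i ∈ σ
      · simpa only [c, dif_pos hi] using hv _
      · simp only [c, dif_neg hi, le_refl]
    · rw [← Finset.sum_coe_sort σ, ← e.sum_comp fun i : σ => c v i, ← sum_cornerCoord v]
      exact Finset.sum_congr rfl fun j _ => hce v j
  have hcard : ∀ j, (σ.erase (e j)).card ≤ k + 1 := fun j => by
    rw [Finset.card_erase_of_mem (e j).2, hσ]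
    rfl
  have hbd : ∀ z ∈ Metric.sphere (0 : EuclideanSpace ℝ (Fin (k + 1))) 1,
      ∃ j, c (H.symm z) ∈ finsetSimplex (σ.erase (e j)) := by
    intro z hz
    rw [← H.apply_symm_apply z, (hH _).2] at hz
    obtain ⟨hz0, j, hj⟩ := hz
    refine ⟨j, mem_finsetSimplex_of_subset (Finset.erase_subset _ _) (hcmem _ hz0) fun i hi => ?_⟩
    by_cases hiσ : i ∈ σ
    · have : i = e j := by
        by_contra hne
        exact hi (Finset.mem_erase.2 ⟨hne, hiσ⟩)
      rw [this, hce, hj]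
    · exact (hcmem _ hz0).2.1 i hiσ
  have hcont : ContinuousOn u (⋃ j ∈ (Finset.univ : Finset (Fin (k + 2))),
      finsetSimplex (σ.erase (e j))) :=
    continuousOn_biUnion_finset _ (fun j _ => isClosed_finsetSimplex _)
      fun j _ => (hu _ (Finset.erase_subset _ _) (hcard j)).1
  obtain ⟨G, hG, hGB, hGf⟩ := h (fun z => u (c (H.symm z)))
    (hcont.comp_continuous (hc.comp (H.symm.continuous.comp continuous_subtype_val)) fun z => by
      simpa using hbd z z.2)
    (by
      rintro _ ⟨z, rfl⟩
      obtain ⟨j, hj⟩ := hbd z z.2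
      exact (hu _ (Finset.erase_subset _ _) (hcard j)).2 hj)
  have hball : ∀ p ∈ finsetSimplex σ, H (d p) ∈ Metric.closedBall 0 1 := fun p hp =>
    (hH _).1.2 fun j => by
      rw [hdc p hp]
      exact hp.1 _
  have hG' : ∀ p (hp : p ∈ finsetSimplex σ), (if hp : H (d p) ∈ Metric.closedBall 0 1 then
      G ⟨H (d p), hp⟩ else u p) = G ⟨H (d p), hball p hp⟩ := fun p hp => dif_pos (hball p hp)
  refine ⟨fun p => if hp : H (d p) ∈ Metric.closedBall 0 1 then G ⟨H (d p), hp⟩ else u p,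
    ?_, fun p hp => ?_, fun τ hτσ hτ p hp => ?_⟩
  · rw [continuousOn_iff_continuous_domRestrict]
    have : Continuous fun p : finsetSimplex σ =>
        G ⟨H (d p), hball p p.2⟩ :=
      hG.comp ((H.continuous.comp (hd.comp continuous_subtype_val)).subtype_mk _)
    exact this.congr fun p => (hG' p p.2).symm
  · simp only [hG' p hp]
    exact hGB ⟨_, rfl⟩
  · have hpσ := finsetSimplex_mono hτσ hp
    obtain ⟨i, hiσ, hiτ⟩ := Finset.exists_mem_notMem_of_card_lt_card (by omega : τ.card < σ.card)
    have hsph : H (d p) ∈ Metric.sphere 0 1 := (hH _).2.2 ⟨fun j => by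
      rw [hdc p hpσ]
      exact hp.1 _, e.symm ⟨i, hiσ⟩, by
      rw [hdc p hpσ, e.apply_symm_apply]
      exact hp.2.1 i hiτ⟩
    simp only [hG' p hpσ]
    refine (hGf ⟨_, hsph⟩).trans ?_
    simp only [H.symm_apply_apply, hcd p hpσ]

theorem EmbedIn.subset {Y : Type*} [TopologicalSpace Y] {k : ℕ} {S B : Set Y}
    (h : EmbedIn k S B) : S ⊆ B := by
  intro y hy
  obtain ⟨g, -, hg, hgf⟩ := h (fun _ => y) continuous_const (by
    rintro _ ⟨z, rfl⟩
    exact hy)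
  have hz : EuclideanSpace.single (0 : Fin (k + 1)) (1 : ℝ) ∈ Metric.sphere 0 1 := by simp
  rw [← hgf ⟨_, hz⟩]
  exact hg ⟨_, rfl⟩

/-- An open cover of a paracompact space has a closed shrinking `F` such that each point `x` has
a neighbourhood contained in `U i` whenever `x ∈ F i`, and disjoint from `F i` otherwise. -/
theorem exists_shrinking_nhds {X I : Type*} [TopologicalSpace X] [T2Space X] [ParacompactSpace X]
    {U : I → Set X} (hU : ∀ i, IsOpen (U i)) (hcov : ∀ x, ∃ i, x ∈ U i) :
    ∃ F : I → Set X, (∀ x, ∃ i, x ∈ F i) ∧ (∀ i, F i ⊆ U i) ∧ (∀ x, {i | x ∈ F i}.Finite) ∧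
      ∀ x, ∃ N : Set X, IsOpen N ∧ x ∈ N ∧
        ∀ z ∈ N, (∀ i, x ∈ F i → z ∈ U i) ∧ ∀ i, z ∈ F i → x ∈ F i := by
  obtain ⟨V, hVo, hVcov, hVf, hVU⟩ :=
    precise_refinement U hU (Set.iUnion_eq_univ_iff.2 hcov)
  obtain ⟨F, hFcov, hFc, hFV⟩ := exists_iUnion_eq_closed_subset hVo hVf.point_finite hVcov
  have hFf : LocallyFinite F := hVf.subset hFV
  refine ⟨F, Set.iUnion_eq_univ_iff.1 hFcov, fun i => (hFV i).trans (hVU i), hFf.point_finite,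
    fun x => ⟨(⋂ i ∈ {i | x ∈ F i}, U i) ∩ ⋂ i, ⋂ (_ : x ∉ F i), (F i)ᶜ, ?_, ?_, ?_⟩⟩
  · refine ((hFf.point_finite x).isOpen_biInter fun i _ => hU i).inter ?_
    have h : IsClosed (⋃ i : {i // x ∉ F i}, F i) :=
      (hFf.comp_injective Subtype.val_injective).isClosed_iUnion fun i => hFc i
    convert h.isOpen_compl using 1
    simp [Set.compl_iUnion, Set.iInter_subtype]
  · simp only [Set.mem_inter_iff, Set.mem_iInter, Set.mem_compl_iff]
    exact ⟨fun i hi => hVU i (hFV i hi), fun i hi => hi⟩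
  · intro z hz
    simp only [Set.mem_inter_iff, Set.mem_iInter, Set.mem_compl_iff] at hz
    exact ⟨hz.1, fun i hi => by_contra fun h => hz.2 i h hi⟩

theorem exists_barycentric_refinement {X I : Type*} [TopologicalSpace X] [T2Space X]
    [ParacompactSpace X] {U : I → Set X} (hU : ∀ i, IsOpen (U i)) (hcov : ∀ x, ∃ i, x ∈ U i) :
    ∃ W : X → Set X, (∀ y, IsOpen (W y)) ∧ (∀ y, y ∈ W y) ∧
      ∀ z, ∃ i, ∀ y, z ∈ W y → W y ⊆ U i := by
  obtain ⟨F, hFcov, -, -, hN⟩ := exists_shrinking_nhds hU hcov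
  choose N hNo hxN hN using hN
  refine ⟨N, hNo, hxN, fun z => ?_⟩
  obtain ⟨i, hi⟩ := hFcov z
  exact ⟨i, fun y hy w hw => (hN y w hw).1 i ((hN y z hy).2 i hi)⟩

/-- `u` is continuous on every simplex of dimension at most `k` of the nerve of `U`, and maps it
into `Φ x` for all `x` in the intersection of the members of `U` corresponding to its vertices. -/
def IsSkeletalSelection {X I Y : Type*} [TopologicalSpace Y] (k : ℕ) (Φ : X → Set Y)
    (U : I → Set X) (u : (I → ℝ) → Y) : Prop :=
  ∀ σ : Finset I, σ.card ≤ k + 1 → ∀ x, (∀ i ∈ σ, x ∈ U i) →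
    ContinuousOn u (finsetSimplex σ) ∧ Set.MapsTo u (finsetSimplex σ) (Φ x)

theorem LowerLocallyConstant.exists_isSkeletalSelection_zero {X Y : Type*} [TopologicalSpace X]
    [Nonempty X] [TopologicalSpace Y] {Φ : X → Set Y} (hΦ : LowerLocallyConstant Φ)
    (hne : ∀ x, (Φ x).Nonempty) :
    ∃ U : X → Set X, (∀ x, IsOpen (U x)) ∧ (∀ x, x ∈ U x) ∧
      ∃ u : (X → ℝ) → Y, IsSkeletalSelection 0 Φ U u := by
  classical
  choose y hy using hne
  refine ⟨fun x => {z | {y x} ⊆ Φ z}, fun x => hΦ _ isCompact_singleton,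
    fun x => Set.singleton_subset_iff.2 (hy x),
    fun p => y (Classical.epsilon fun i => p i ≠ 0), fun σ hσ x hx => ?_⟩
  rcases σ.eq_empty_or_nonempty with rfl | hσne
  · have : finsetSimplex (∅ : Finset X) = ∅ :=
      Set.eq_empty_of_forall_notMem fun p hp => by simpa using hp.2.2
    rw [this]
    exact ⟨continuousOn_empty _, Set.mapsTo_empty _ _⟩
  · obtain ⟨i, rfl⟩ := Finset.card_eq_one.1 (le_antisymm hσ hσne.card_pos)
    have h : ∀ p ∈ finsetSimplex {i}, y (Classical.epsilon fun j => p j ≠ 0) = y i := by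
      intro p hp
      have h1 : p i = 1 := by simpa using hp.2.2
      have h2 : p (Classical.epsilon fun j => p j ≠ 0) ≠ 0 :=
        Classical.epsilon_spec (p := fun j => p j ≠ 0) ⟨i, by simp [h1]⟩
      by_contra hne
      exact h2 (hp.2.1 _ fun hmem => hne (congrArg y (Finset.mem_singleton.1 hmem)))
    refine ⟨continuousOn_const.congr h, fun p hp => ?_⟩
    simp only [h p hp]
    exact hx i (Finset.mem_singleton_self i) rfl

open Classical in
/-- The finite set of vertices at which `q` is nonzero. -/
noncomputable def vertexSupport {I : Type*} (q : I → ℝ) : Finset I :=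
  if h : (Function.support q).Finite then h.toFinset else ∅

theorem vertexSupport_subset {I : Type*} {q : I → ℝ} {τ : Finset I} (hq : q ∈ finsetSimplex τ) :
    vertexSupport q ⊆ τ ∧ q ∈ finsetSimplex (vertexSupport q) := by
  have hsub : Function.support q ⊆ τ := fun i hi => by_contra fun h => hi (hq.2.1 i h)
  have hfin : (Function.support q).Finite := τ.finite_toSet.subset hsub
  have hsupp : vertexSupport q = hfin.toFinset := dif_pos hfin
  have hτ : vertexSupport q ⊆ τ := by
    rw [hsupp]
    exact fun i hi => hsub (hfin.mem_toFinset.1 hi)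
  refine ⟨hτ, mem_finsetSimplex_of_subset hτ hq fun i hi => ?_⟩
  simpa [hsupp] using hi

/-- Passing to a finer cover, a skeletal selection extends to the next skeleton. -/
theorem IsSkeletalSelection.exists_succ {X I Y : Type*} [TopologicalSpace X] [T2Space X]
    [ParacompactSpace X] [Nonempty X] [TopologicalSpace Y] {k : ℕ} {Φ Ψ : X → Set Y}
    (hΨ : LowerLocallyConstant Ψ) (hΦΨ : ∀ x, EmbedIn k (Φ x) (Ψ x)) {U : I → Set X}
    (hU : ∀ i, IsOpen (U i)) (hcov : ∀ x, ∃ i, x ∈ U i) {u : (I → ℝ) → Y}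
    (hu : IsSkeletalSelection k Φ U u) :
    ∃ W : X → Set X, (∀ x, IsOpen (W x)) ∧ (∀ x, x ∈ W x) ∧
      ∃ w : (X → ℝ) → Y, IsSkeletalSelection (k + 1) Ψ W w := by
  classical
  obtain ⟨F, hFcov, hFU, hFfin, hN⟩ := exists_shrinking_nhds hU hcov
  choose N hNo hxN hN using hN
  have hext : ∀ (σ : Finset I) (x : X), ∃ g : (I → ℝ) → Y, σ.card ≤ k + 2 → (∀ i ∈ σ, x ∈ F i) →
      ContinuousOn g (finsetSimplex σ) ∧ Set.MapsTo g (finsetSimplex σ) (Ψ x) ∧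
        ∀ τ ⊆ σ, τ.card ≤ k + 1 → Set.EqOn g u (finsetSimplex τ) := by
    intro σ x
    by_cases hx : ∀ i ∈ σ, x ∈ F i
    · have hux : ∀ τ ⊆ σ, τ.card ≤ k + 1 →
          ContinuousOn u (finsetSimplex τ) ∧ Set.MapsTo u (finsetSimplex τ) (Φ x) :=
        fun τ hτ hcard => hu τ hcard x fun i hi => hFU i (hx i (hτ hi))
      by_cases hσ : σ.card = k + 2
      · obtain ⟨g, hg⟩ := (hΦΨ x).exists_extension_finsetSimplex hσ hux
        exact ⟨g, fun _ _ => hg⟩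
      · refine ⟨u, fun hle _ => ?_⟩
        obtain ⟨h1, h2⟩ := hux σ subset_rfl (by omega)
        exact ⟨h1, h2.mono_right (hΦΨ x).subset, fun τ _ _ p _ => rfl⟩
    · exact ⟨u, fun _ h => absurd h hx⟩
  choose g hg using hext
  have hO : ∀ x, ∃ O : Set X, IsOpen O ∧ x ∈ O ∧ O ⊆ N x ∧
      ∀ σ : Finset I, σ.card ≤ k + 2 → (∀ i ∈ σ, x ∈ F i) →
        ∀ z ∈ O, Set.MapsTo (g σ x) (finsetSimplex σ) (Ψ z) := by
    intro x
    let T : Finset (Finset I) := (hFfin x).toFinset.powerset.filter fun σ => σ.card ≤ k + 2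
    have hT : ∀ σ, σ ∈ T ↔ (∀ i ∈ σ, x ∈ F i) ∧ σ.card ≤ k + 2 := fun σ => by
      simp [T, Finset.subset_iff]
    refine ⟨N x ∩ ⋂ σ ∈ T, {z | g σ x '' finsetSimplex σ ⊆ Ψ z}, ?_, ?_, Set.inter_subset_left, ?_⟩
    · refine (hNo x).inter (isOpen_biInter_finset fun σ hσ => hΨ _ ?_)
      obtain ⟨hσF, hσ⟩ := (hT σ).1 hσ
      exact (isCompact_finsetSimplex σ).image_of_continuousOn (hg σ x hσ hσF).1
    · refine ⟨hxN x, Set.mem_iInter₂.2 fun σ hσ => ?_⟩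
      obtain ⟨hσF, hσ⟩ := (hT σ).1 hσ
      exact (hg σ x hσ hσF).2.1.image_subset
    · intro σ hσ hσF z hz
      exact Set.mapsTo_iff_image_subset.2 (Set.mem_iInter₂.1 hz.2 σ ((hT σ).2 ⟨hσF, hσ⟩))
  choose O hOo hxO hON hOg using hO
  obtain ⟨W, hWo, hxW, hW⟩ := exists_barycentric_refinement hOo fun x => ⟨x, hxO x⟩
  choose r hr using hFcov
  have hb : ∀ τ : Finset X, ∃ x, (∃ z, ∀ y ∈ τ, z ∈ W y) → ∀ y ∈ τ, W y ⊆ O x := by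
    intro τ
    by_cases h : ∃ z, ∀ y ∈ τ, z ∈ W y
    · obtain ⟨z, hz⟩ := h
      obtain ⟨x, hx⟩ := hW z
      exact ⟨x, fun _ y hy => hx y (hz y hy)⟩
    · exact ⟨Classical.arbitrary X, fun h' => absurd h' h⟩
  choose b hb using hb
  refine ⟨W, hWo, hxW, fun q => g ((vertexSupport q).image r) (b (vertexSupport q))
    (vertexPushforward r q), fun τ hτ z hz => ?_⟩
  have key : ∀ τ' ⊆ τ, (τ'.image r).card ≤ k + 2 ∧ ∀ i ∈ τ'.image r, b τ' ∈ F i := by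
    refine fun τ' hτ' => ⟨Finset.card_image_le.trans ((Finset.card_le_card hτ').trans hτ), ?_⟩
    intro i hi
    obtain ⟨y, hy, rfl⟩ := Finset.mem_image.1 hi
    exact (hN _ y (hON _ (hb τ' ⟨z, fun y hy => hz y (hτ' hy)⟩ y hy (hxW y)))).2 _ (hr y)
  obtain ⟨hcard, hbF⟩ := key τ subset_rfl
  have heq : Set.EqOn (fun q => g ((vertexSupport q).image r) (b (vertexSupport q))
      (vertexPushforward r q)) (fun q => g (τ.image r) (b τ) (vertexPushforward r q))
      (finsetSimplex τ) := by
    intro q hq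
    obtain ⟨hsub, hq'⟩ := vertexSupport_subset hq
    simp only
    generalize vertexSupport q = τ' at hsub hq'
    rcases hsub.eq_or_ssubset with rfl | hss
    · rfl
    · obtain ⟨hcard', hbF'⟩ := key τ' hsub
      have hlt : (τ'.image r).card ≤ k + 1 := by
        have := Finset.card_lt_card hss
        have := Finset.card_image_le (s := τ') (f := r)
        omega
      have hmem := vertexPushforward_mem r hq'
      rw [(hg _ _ hcard' hbF').2.2 _ subset_rfl hlt hmem,
        (hg _ _ hcard hbF).2.2 _ (Finset.image_subset_image hsub) hlt hmem]
  refine ⟨ContinuousOn.congr ((hg _ _ hcard hbF).1.comp (continuousOn_vertexPushforward r τ)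
    fun q hq => vertexPushforward_mem r hq) heq, fun q hq => ?_⟩
  rw [heq hq]
  rcases τ.eq_empty_or_nonempty with rfl | ⟨y, hy⟩
  · simpa using hq.2.2
  · exact hOg _ _ hcard hbF z (hb τ ⟨z, hz⟩ y hy (hz y hy)) (vertexPushforward_mem r hq)

theorem CovDimLE.exists_precise_refinement {X I : Type*} [TopologicalSpace X] {n : ℕ}
    (hdim : CovDimLE X n) {U : I → Set X} (hU : ∀ i, IsOpen (U i)) (hcov : ∀ x, ∃ i, x ∈ U i) :
    ∃ V : I → Set X, (∀ i, IsOpen (V i)) ∧ (∀ i, V i ⊆ U i) ∧ (∀ x, ∃ i, x ∈ V i) ∧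
      ∀ x, {i | x ∈ V i}.Finite ∧ {i | x ∈ V i}.ncard ≤ n + 1 := by
  obtain ⟨V, hVo, hVU, hVcov, hV⟩ := hdim (Set.range U) (by
    rintro _ ⟨i, rfl⟩
    exact hU i) (by
    rw [Set.sUnion_range]
    exact Set.iUnion_eq_univ_iff.2 hcov)
  have hr : ∀ v : V, ∃ i, (v : Set X) ⊆ U i := fun v => by simpa using hVU v v.2
  choose r hr using hr
  refine ⟨fun i => ⋃ v : V, ⋃ (_ : r v = i), (v : Set X),
    fun i => isOpen_iUnion fun v => isOpen_iUnion fun _ => hVo v v.2,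
    fun i => Set.iUnion_subset fun v => Set.iUnion_subset fun h => h ▸ hr v, fun x => ?_,
    fun x => ?_⟩
  · obtain ⟨v, hv, hx⟩ := Set.mem_sUnion.1 (hVcov ▸ Set.mem_univ x : x ∈ ⋃₀ V)
    exact ⟨r ⟨v, hv⟩, Set.mem_iUnion₂.2 ⟨⟨v, hv⟩, rfl, hx⟩⟩
  · have hfin : {v : V | x ∈ (v : Set X)}.Finite := by
      refine Set.Finite.of_finite_image ((hV x).1.subset ?_) Subtype.val_injective.injOn
      rintro _ ⟨v, hv, rfl⟩
      exact ⟨v.2, hv⟩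
    have hsub : {i | x ∈ ⋃ v : V, ⋃ (_ : r v = i), (v : Set X)} ⊆
        r '' {v : V | x ∈ (v : Set X)} := by
      intro i hi
      obtain ⟨v, hv, hx⟩ := Set.mem_iUnion₂.1 hi
      exact ⟨v, hx, hv⟩
    refine ⟨(hfin.image r).subset hsub, (Set.ncard_le_ncard hsub (hfin.image r)).trans
      ((Set.ncard_image_le hfin).trans (le_trans ?_ (hV x).2))⟩
    rw [← Set.ncard_image_of_injective _ Subtype.val_injective]
    refine Set.ncard_le_ncard ?_ (hV x).1
    rintro _ ⟨v, hv, rfl⟩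
    exact ⟨v.2, hv⟩

theorem IsSkeletalSelection.exists_selection {X I Y : Type*} [TopologicalSpace X] [T2Space X]
    [ParacompactSpace X] [TopologicalSpace Y] {n : ℕ} (hdim : CovDimLE X n) {Φ : X → Set Y}
    {U : I → Set X} (hU : ∀ i, IsOpen (U i)) (hcov : ∀ x, ∃ i, x ∈ U i) {u : (I → ℝ) → Y}
    (hu : IsSkeletalSelection n Φ U u) : ∃ f : X → Y, Continuous f ∧ ∀ x, f x ∈ Φ x := by
  classical
  obtain ⟨V, hVo, hVU, hVcov, hV⟩ := hdim.exists_precise_refinement hU hcov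
  obtain ⟨ρ, hρ⟩ := PartitionOfUnity.exists_isSubordinate isClosed_univ V hVo
    (Set.iUnion_eq_univ_iff.2 hVcov).ge
  let P : X → I → ℝ := fun x i => ρ i x
  have hP : Continuous P := continuous_pi fun i => (ρ i).continuous
  have hfin : ∀ x, (Function.support (P x)).Finite := fun x => ρ.locallyFinite.point_finite x
  have hmemP : ∀ x (σ : Finset I), (∀ i, i ∉ σ → P x i = 0) → P x ∈ finsetSimplex σ := by
    refine fun x σ h => ⟨fun i => ρ.nonneg i x, h, ?_⟩
    rw [← ρ.sum_eq_one (Set.mem_univ x)]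
    exact (finsum_eq_sum_of_support_subset _ fun i hi =>
      by_contra fun hiσ => hi (h i hiσ)).symm
  have hsuppV : ∀ x i, P x i ≠ 0 → x ∈ V i := fun x i hi =>
    hρ i (subset_tsupport _ hi)
  have hself : ∀ x i, i ∉ (hfin x).toFinset → P x i = 0 := fun x i hi => by
    simpa using hi
  have hcard : ∀ x, (hfin x).toFinset.card ≤ n + 1 := fun x => by
    rw [← Set.ncard_eq_toFinset_card _ (hfin x)]
    exact (Set.ncard_le_ncard (hsuppV x) (hV x).1).trans (hV x).2
  have hsk : ∀ x, ContinuousOn u (finsetSimplex (hfin x).toFinset) ∧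
      Set.MapsTo u (finsetSimplex (hfin x).toFinset) (Φ x) := fun x =>
    hu _ (hcard x) x fun i hi => hVU i (hsuppV x i (by simpa using hi))
  refine ⟨fun x => u (P x), continuous_iff_continuousAt.2 fun x₀ => ?_,
    fun x => (hsk x).2 (hmemP x _ (hself x))⟩
  obtain ⟨M, hM, hMfin⟩ := ρ.locallyFinite x₀
  let T : Finset (Finset I) := hMfin.toFinset.powerset.filter fun σ =>
    ContinuousOn u (finsetSimplex σ)
  let A : Finset I → Set X := fun σ => {x | ∀ i, i ∉ σ → P x i = 0}
  have hA : ContinuousOn (fun x => u (P x)) (⋃ σ ∈ T, A σ) := by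
    refine continuousOn_biUnion_finset T (fun σ _ => ?_) fun σ hσ => ?_
    · simp only [A, Set.ofPred_forall]
      exact isClosed_iInter fun i => isClosed_iInter fun _ =>
        isClosed_eq (ρ i).continuous continuous_const
    · exact (Finset.mem_filter.1 hσ).2.comp hP.continuousOn fun x hx => hmemP x σ hx
  refine hA.continuousAt (Filter.mem_of_superset hM fun x hx => ?_)
  refine Set.mem_iUnion₂.2 ⟨(hfin x).toFinset, Finset.mem_filter.2
    ⟨Finset.mem_powerset.2 fun i hi => ?_, (hsk x).1⟩, hself x⟩
  rw [Set.Finite.mem_toFinset] at hi ⊢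
  exact ⟨x, hi, hx⟩

/-- On a paracompact Hausdorff space of covering dimension at most `n`, the last member
of any finite aspherical sequence `φ_0, …, φ_n` of lower locally constant mappings has a
continuous selection. -/
theorem finiteAsphericalSequence_selection_of_covDimLE
    {X : Type*} [TopologicalSpace X] [T2Space X] [ParacompactSpace X] (n : ℕ)
    (hdim : CovDimLE X n)
    {Y : Type*} [TopologicalSpace Y] [T2Space Y] (φ : ℕ → X → Set Y)
    (hne : ∀ k, k ≤ n → ∀ x, (φ k x).Nonempty)
    (hllc : ∀ k, k ≤ n → LowerLocallyConstant (φ k))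
    (hasph : ∀ k, k < n → ∀ x, EmbedIn k (φ k x) (φ (k + 1) x)) :
    ∃ f : X → Y, Continuous f ∧ ∀ x, f x ∈ φ n x := by
  rcases isEmpty_or_nonempty X with hX | hX
  · exact ⟨isEmptyElim, continuous_of_const fun x => isEmptyElim x, fun x => isEmptyElim x⟩
  have hskel : ∀ k, k ≤ n → ∃ U : X → Set X, (∀ x, IsOpen (U x)) ∧ (∀ x, x ∈ U x) ∧
      ∃ u : (X → ℝ) → Y, IsSkeletalSelection k (φ k) U u := by
    intro k
    induction k with
    | zero => exact fun h => (hllc 0 h).exists_isSkeletalSelection_zero (hne 0 h)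
    | succ k ih =>
      intro h
      obtain ⟨U, hU, hxU, u, hu⟩ := ih (by omega)
      exact hu.exists_succ (hllc _ h) (hasph k h) hU fun x => ⟨x, hxU x⟩
  obtain ⟨U, hU, hxU, u, hu⟩ := hskel n le_rfl
  exact hu.exists_selection hdim hU fun x => ⟨x, hxU x⟩
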